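/- Let T > 0 and p ∈ (1, ∞). Let u₁, u₂ : [0,T] × 𝕋² → ℝ² be Borel vector fields with ∫_0^T ‖u_i(s,·)‖_{L¹(𝕋²)} ds < ∞ for i = 1,2, and assume u₁(s,·) is continuously differentiable for almost every s with A := ∫_0^T ‖∇_x u₁(s,·)‖_{L^p(𝕋²)} ds < ∞. Fix t ∈ [0,T] and for i = 1,2 let X_i : [0,t] × 𝕋² → 𝕋² be maps such that: (i) for almost every x ∈ 𝕋², the curve s ↦ X_i(s,x) is absolutely continuous on [0,t], X_i(t,x) = x, and ∂_s X_i(s,x) = u_i(s, X_i(s,x)) for almost every s ∈ [0,t]; and (ii) for each s ∈ [0,t], the map X_i(s,·) : 𝕋² → 𝕋² preserves Lebesgue measure. Then there exist constants δ₀ ∈ (0,1) (universal) and C > 0 depending only on p such that: if δ := ∫_0^T ‖u₁(s,·) − u₂(s,·)‖_{L¹(𝕋²)} ds satisfies 0 < δ ≤ δ₀, then for every s ∈ [0,t], ∫_{𝕋²} d_{𝕋²}(X₁(s,x), X₂(s,x)) dx ≤ C (1 + A) / |log δ|. -/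

import Mathlib

open MeasureTheory
open scoped ENNReal

/-- The flat torus `𝕋² = ℝ²/ℤ²` is modelled by `ℤ²`-periodic functions on `ℝ × ℝ`,
with integration over the fundamental domain `[0,1]²` (total mass 1). -/
noncomputable def μT : Measure (ℝ × ℝ) := volume.restrict (Set.Icc ((0:ℝ), (0:ℝ)) (1, 1))

/-- `ℤ²`-periodicity. -/
def ZZper {α : Type*} (f : ℝ × ℝ → α) : Prop :=
  ∀ (x : ℝ × ℝ) (m n : ℤ), f (x + ((m : ℝ), (n : ℝ))) = f x

/-- The geodesic distance on the torus `ℝ²/ℤ²`, expressed on lifts. -/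
noncomputable def dT2 (a b : ℝ × ℝ) : ℝ :=
  ⨅ mn : ℤ × ℤ, ‖a - b + (((mn.1 : ℝ), (mn.2 : ℝ)) : ℝ × ℝ)‖

/-- `X` is a (backward, measure-preserving) regular Lagrangian flow of `u` on `[0,t] × 𝕋²`:
for a.e. `x` the curve `s ↦ X(s,x)` is an absolutely continuous integral solution of
`∂ₛX = u(s,X)`, `X(t,x) = x`, and every `X(s,·)` preserves the Lebesgue measure of the torus. -/
def IsRegLagFlow (t : ℝ) (u : ℝ → ℝ × ℝ → ℝ × ℝ) (X : ℝ → ℝ × ℝ → ℝ × ℝ) : Prop :=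
  (∀ s, Measurable (X s)) ∧
  (∀ᵐ x ∂μT,
    IntervalIntegrable (fun τ => u τ (X τ x)) MeasureTheory.volume 0 t ∧
    ∀ s ∈ Set.Icc (0:ℝ) t, X s x = x - ∫ τ in s..t, u τ (X τ x)) ∧
  (∀ s ∈ Set.Icc (0:ℝ) t, ∀ g : ℝ × ℝ → ℝ≥0∞, Measurable g → ZZper g →
    ∫⁻ x, g (X s x) ∂μT = ∫⁻ x, g x ∂μT)


lemma ac_log_max {W : ℝ → ℝ} {a b δ : ℝ} (hδ : 0 < δ)
    (hW : AbsolutelyContinuousOnInterval W a b) :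
    AbsolutelyContinuousOnInterval (fun r => Real.log (max δ (W r))) a b := by
  have key : ∀ x y : ℝ, dist (Real.log (max δ x)) (Real.log (max δ y)) ≤ δ⁻¹ * dist x y := by
    have aux : ∀ x y : ℝ, x ≤ y → |Real.log (max δ x) - Real.log (max δ y)| ≤ δ⁻¹ * |x - y| := by
      intro x y hxy
      have h1 : 0 < max δ x := lt_max_of_lt_left hδ
      have h2 : 0 < max δ y := lt_max_of_lt_left hδ
      have h3 : max δ x ≤ max δ y := max_le_max le_rfl hxy
      have h4 : Real.log (max δ x) ≤ Real.log (max δ y) := Real.log_le_log h1 h3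
      rw [abs_sub_comm, abs_of_nonneg (by linarith), abs_sub_comm, abs_of_nonneg (by linarith),
        ← Real.log_div h2.ne' h1.ne']
      have h5 := Real.log_le_sub_one_of_pos (div_pos h2 h1)
      have h6 : max δ y - max δ x ≤ y - x := by
        rcases le_total δ x with h | h <;> rcases le_total δ y with h' | h' <;>
          simp [h, h'] <;> linarith
      calc _ ≤ max δ y / max δ x - 1 := h5
        _ = (max δ x)⁻¹ * (max δ y - max δ x) := by field_simp
        _ ≤ δ⁻¹ * (y - x) := by
          gcongr
          exact le_max_left _ _
    intro x y
    rw [Real.dist_eq, Real.dist_eq]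
    rcases le_total x y with h | h
    · exact aux x y h
    · rw [abs_sub_comm, abs_sub_comm x y]; exact aux y x h
  refine squeeze_zero (fun t => ?_) (fun t => ?_)
    (by simpa using Filter.Tendsto.const_mul δ⁻¹ hW)
  · exact Finset.sum_nonneg (fun i hi => dist_nonneg)
  · simp only [Finset.mul_sum]
    exact Finset.sum_le_sum fun i _ => key _ _

lemma log_gronwall {s t δ : ℝ} (hst : s ≤ t) (hδ : 0 < δ) {h D : ℝ → ℝ} (hh : ∀ r, 0 ≤ h r)
    (hi : IntervalIntegrable h volume s t)
    (hD0 : ∀ r ∈ Set.Icc s t, 0 ≤ D r) (hD : ∀ r ∈ Set.Icc s t, D r ≤ ∫ τ in r..t, h τ) :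
    ENNReal.ofReal (Real.log (1 + D s / δ)) ≤
      ∫⁻ r in Set.Ioc s t, ENNReal.ofReal (h r / (δ + D r)) := by
  set W : ℝ → ℝ := fun r => δ - ∫ τ in t..r, h τ with hWdef
  have hWac : AbsolutelyContinuousOnInterval W s t := by
    have h1 := hi.absolutelyContinuousOnInterval_intervalIntegral (c := t) (by simp)
    have h2 : AbsolutelyContinuousOnInterval (fun _ : ℝ => δ) s t :=
      (LipschitzWith.const (α := ℝ) δ).lipschitzOnWith.absolutelyContinuousOnInterval
    exact h2.fun_sub h1
  have hF := ac_log_max hδ hWac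
  have hWD : ∀ r ∈ Set.Icc s t, δ + D r ≤ W r := by
    intro r hr
    have := hD r hr
    rw [hWdef]; simp only
    rw [intervalIntegral.integral_symm]; linarith
  have hWδ : ∀ r ∈ Set.Icc s t, δ ≤ W r := fun r hr => by
    linarith [hWD r hr, hD0 r hr]
  have hs : s ∈ Set.Icc s t := ⟨le_rfl, hst⟩
  have ht : t ∈ Set.Icc s t := ⟨hst, le_rfl⟩
  have hint := hF.integral_deriv_eq_sub
  have hWcont : ContinuousOn W (Set.Icc s t) := by
    simpa [Set.uIcc_of_le hst] using hWac.continuousOn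
  have hderiv : ∀ᵐ r ∂volume.restrict (Set.Ioc s t),
      deriv (fun r => Real.log (max δ (W r))) r = - (h r / W r) := by
    have h1 := hi.ae_hasDerivAt_integral
    have h2 : ∀ᵐ r : ℝ, r ≠ t := by simp [ae_iff, measure_singleton]
    rw [ae_restrict_iff' measurableSet_Ioc]
    filter_upwards [h1, h2] with r hr hrt hrm
    have hrm' : r ∈ Set.Ioo s t := ⟨hrm.1, lt_of_le_of_ne hrm.2 hrt⟩
    have h3 := hr (by rw [Set.uIcc_of_le hst]; exact ⟨hrm.1.le, hrm.2⟩) t (by simp)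
    have h4 : HasDerivAt W (- h r) r := by
      exact h3.const_sub δ
    have hpos : 0 < W r := lt_of_lt_of_le hδ (hWδ r ⟨hrm.1.le, hrm.2⟩)
    have h5 := h4.log hpos.ne'
    have h6 : (fun r => Real.log (max δ (W r))) =ᶠ[nhds r] fun r => Real.log (W r) := by
      filter_upwards [isOpen_Ioo.mem_nhds hrm'] with y hy
      rw [max_eq_right (hWδ y ⟨hy.1.le, hy.2.le⟩)]
    rw [h6.deriv_eq, h5.deriv]; ring
  have hintW : Integrable (fun r => h r / W r) (volume.restrict (Set.Ioc s t)) := by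
    have h1 := hF.intervalIntegrable_deriv
    rw [intervalIntegrable_iff_integrableOn_Ioc_of_le hst] at h1
    refine (h1.neg).congr ?_
    filter_upwards [hderiv] with r hr
    simp [hr]
  have heq : ∫ r in Set.Ioc s t, h r / W r = Real.log (W s) - Real.log δ := by
    rw [intervalIntegral.integral_of_le hst, integral_congr_ae hderiv, integral_neg,
      max_eq_right (hWδ s hs)] at hint
    have : W t = δ := by simp [hWdef]
    rw [this, max_self] at hint
    linarith
  have hWs : 0 < W s := lt_of_lt_of_le hδ (hWδ s hs)
  calc ENNReal.ofReal (Real.log (1 + D s / δ))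
      ≤ ENNReal.ofReal (Real.log (W s) - Real.log δ) := by
        apply ENNReal.ofReal_le_ofReal
        rw [← Real.log_div hWs.ne' hδ.ne']
        apply Real.log_le_log
        · have := div_nonneg (hD0 s hs) hδ.le; linarith
        · rw [le_div_iff₀ hδ]
          have := hWD s hs
          field_simp; linarith
    _ = ∫⁻ r in Set.Ioc s t, ENNReal.ofReal (h r / W r) := by
        rw [← heq, ofReal_integral_eq_lintegral_ofReal hintW]
        filter_upwards [ae_restrict_mem measurableSet_Ioc] with r hr
        exact div_nonneg (hh r) (hδ.le.trans (hWδ r ⟨hr.1.le, hr.2⟩))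
    _ ≤ _ := by
        apply lintegral_mono_ae
        filter_upwards [ae_restrict_mem measurableSet_Ioc] with r hr
        apply ENNReal.ofReal_le_ofReal
        have hr' : r ∈ Set.Icc s t := ⟨hr.1.le, hr.2⟩
        have := hD0 r hr'
        exact div_le_div_of_nonneg_left (hh r) (by linarith) (hWD r hr')

lemma vol_closedBall2 (x : ℝ × ℝ) {r : ℝ} (hr : 0 ≤ r) :
    volume (Metric.closedBall x r) = ENNReal.ofReal (4 * r ^ 2) := by
  obtain ⟨a, b⟩ := x
  rw [← closedBall_prod_same, Measure.volume_eq_prod, Measure.prod_prod, Real.volume_closedBall,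
    Real.volume_closedBall, ← ENNReal.ofReal_mul (by linarith)]
  congr 1; ring

lemma lintegral_scale {F : ℝ × ℝ → ℝ≥0∞} (hF : Measurable F) (x : ℝ × ℝ) {ρ : ℝ} (hρ : 0 < ρ) :
    ∫⁻ z in Metric.closedBall x ρ, F z =
      ENNReal.ofReal (ρ ^ 2) * ∫⁻ w in Metric.closedBall (0 : ℝ × ℝ) 1, F (x + ρ • w) := by
  set G := (Metric.closedBall x ρ).indicator F with hG
  have hGm : Measurable G := hF.indicator measurableSet_closedBall
  have h1 : ∀ w, (Metric.closedBall (0 : ℝ × ℝ) 1).indicator (fun w => F (x + ρ • w)) w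
      = G (x + ρ • w) := by
    intro w
    have : w ∈ Metric.closedBall (0 : ℝ × ℝ) 1 ↔ x + ρ • w ∈ Metric.closedBall x ρ := by
      rw [mem_closedBall_zero_iff, mem_closedBall_iff_norm, add_sub_cancel_left, norm_smul,
        Real.norm_of_nonneg hρ.le]
      constructor <;> intro h <;> nlinarith
    by_cases hw : w ∈ Metric.closedBall (0 : ℝ × ℝ) 1
    · rw [Set.indicator_of_mem hw, hG, Set.indicator_of_mem (this.1 hw)]
    · rw [Set.indicator_of_notMem hw, hG, Set.indicator_of_notMem (fun h => hw (this.2 h))]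
  rw [← lintegral_indicator measurableSet_closedBall, ← lintegral_indicator measurableSet_closedBall]
  simp_rw [h1]
  have h2 : ∫⁻ w, G (x + ρ • w) = ∫⁻ z, G (x + z) ∂(Measure.map (ρ • ·) (volume : Measure (ℝ × ℝ))) := by
    rw [lintegral_map (show Measurable fun z => G (x + z) from hGm.comp (measurable_const_add x))
      (measurable_const_smul ρ)]
  rw [h2, Measure.map_addHaar_smul _ hρ.ne', lintegral_smul_measure,
    lintegral_add_left_eq_self G x, smul_eq_mul, ← mul_assoc]
  have : Module.finrank ℝ (ℝ × ℝ) = 2 := by simp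
  rw [this, ← ENNReal.ofReal_mul (by positivity), abs_of_pos (by positivity),
    mul_inv_cancel₀ (by positivity)]
  simp [hG]

/-- Dyadic maximal difference quotient. -/
noncomputable def gmax (u : ℝ × ℝ → ℝ × ℝ) (x : ℝ × ℝ) : ℝ≥0∞ :=
  ⨆ k : ℕ, ENNReal.ofReal (2 ^ k) *
    ∫⁻ w in Metric.closedBall (0 : ℝ × ℝ) 1, ‖u (x + ((1 / 2 : ℝ) ^ k) • w) - u x‖ₑ

lemma gmax_per {u : ℝ × ℝ → ℝ × ℝ} (hu : ZZper u) : ZZper (gmax u) := by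
  intro x m n
  unfold gmax
  congr 1; ext k
  congr 2; ext w
  rw [hu x m n, add_right_comm, hu]

lemma gmax_measurable {u : ℝ → ℝ × ℝ → ℝ × ℝ}
    (hu : Measurable (fun q : ℝ × (ℝ × ℝ) => u q.1 q.2)) :
    Measurable (fun q : ℝ × (ℝ × ℝ) => gmax (u q.1) q.2) := by
  unfold gmax
  refine Measurable.iSup fun k => Measurable.const_mul ?_ _
  apply Measurable.lintegral_prod_right'
    (f := fun z : (ℝ × (ℝ × ℝ)) × (ℝ × ℝ) =>
      ‖u z.1.1 (z.1.2 + ((1 / 2 : ℝ) ^ k) • z.2) - u z.1.1 z.1.2‖ₑ)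
  apply Measurable.enorm
  apply Measurable.sub
  · exact hu.comp (f := fun z : (ℝ × (ℝ × ℝ)) × (ℝ × ℝ) =>
      (z.1.1, z.1.2 + ((1 / 2 : ℝ) ^ k) • z.2)) (by fun_prop)
  · exact hu.comp (f := fun z : (ℝ × (ℝ × ℝ)) × (ℝ × ℝ) => (z.1.1, z.1.2)) (by fun_prop)

lemma gmax_near {u : ℝ × ℝ → ℝ × ℝ} (hu : Measurable u) (x y : ℝ × ℝ) (hxy : ‖x - y‖ ≤ 1 / 2) :
    ‖u x - u y‖ₑ ≤ 4 * ‖x - y‖ₑ * (gmax u x + gmax u y) := by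
  rcases eq_or_ne x y with rfl | hne
  · simp
  have hpos : 0 < ‖x - y‖ := norm_pos_iff.2 (sub_ne_zero.2 hne)
  obtain ⟨k, hk1, hk2⟩ := exists_nat_pow_near_of_lt_one hpos (by linarith : ‖x - y‖ ≤ 1)
    (by norm_num : (0:ℝ) < 1 / 2) (by norm_num)
  have hk0 : k ≠ 0 := by
    rintro rfl
    norm_num at hk1
    linarith
  obtain ⟨j, rfl⟩ := Nat.exists_eq_succ_of_ne_zero hk0
  set r : ℝ := (1 / 2 : ℝ) ^ (j + 1) with hr
  have hr0 : 0 < r := by positivity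
  have hrj : (1 / 2 : ℝ) ^ j = 2 * r := by rw [hr, pow_succ]; ring
  have hr2 : (2 : ℝ) ^ (j + 1) = r⁻¹ := by rw [hr]; simp
  have hr3 : (2 : ℝ) ^ j = (2 * r)⁻¹ := by rw [← hrj]; simp
  have hrle : r ≤ 2 * ‖x - y‖ := by
    rw [pow_succ] at hk1; linarith
  have hIx : ∫⁻ w in Metric.closedBall (0 : ℝ × ℝ) 1, ‖u (x + r • w) - u x‖ₑ
      ≤ ENNReal.ofReal r * gmax u x := by
    have h1 : ENNReal.ofReal r⁻¹ *
        ∫⁻ w in Metric.closedBall (0 : ℝ × ℝ) 1, ‖u (x + r • w) - u x‖ₑ ≤ gmax u x := by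
      rw [← hr2, hr]; exact le_iSup (fun k : ℕ => ENNReal.ofReal (2 ^ k) *
        ∫⁻ w in Metric.closedBall (0 : ℝ × ℝ) 1, ‖u (x + ((1 / 2 : ℝ) ^ k) • w) - u x‖ₑ) (j + 1)
    calc _ = ENNReal.ofReal r * (ENNReal.ofReal r⁻¹ *
        ∫⁻ w in Metric.closedBall (0 : ℝ × ℝ) 1, ‖u (x + r • w) - u x‖ₑ) := by
          rw [← mul_assoc, ← ENNReal.ofReal_mul hr0.le, mul_inv_cancel₀ hr0.ne']; simp
      _ ≤ _ := by gcongr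
  have hIy : ∫⁻ w in Metric.closedBall (0 : ℝ × ℝ) 1, ‖u (y + (2 * r) • w) - u y‖ₑ
      ≤ ENNReal.ofReal (2 * r) * gmax u y := by
    have h1 : ENNReal.ofReal (2 * r)⁻¹ *
        ∫⁻ w in Metric.closedBall (0 : ℝ × ℝ) 1, ‖u (y + (2 * r) • w) - u y‖ₑ ≤ gmax u y := by
      rw [← hr3, ← hrj]; exact le_iSup (fun k : ℕ => ENNReal.ofReal (2 ^ k) *
        ∫⁻ w in Metric.closedBall (0 : ℝ × ℝ) 1, ‖u (y + ((1 / 2 : ℝ) ^ k) • w) - u y‖ₑ) j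
    calc _ = ENNReal.ofReal (2 * r) * (ENNReal.ofReal (2 * r)⁻¹ *
        ∫⁻ w in Metric.closedBall (0 : ℝ × ℝ) 1, ‖u (y + (2 * r) • w) - u y‖ₑ) := by
          rw [← mul_assoc, ← ENNReal.ofReal_mul (by positivity), mul_inv_cancel₀ (by positivity)]
          simp
      _ ≤ _ := by gcongr
  have hm : Measurable fun z => ‖u z - u y‖ₑ := (hu.sub_const _).enorm
  have hJ : ∫⁻ w in Metric.closedBall (0 : ℝ × ℝ) 1, ‖u (x + r • w) - u y‖ₑ
      ≤ 4 * ∫⁻ w in Metric.closedBall (0 : ℝ × ℝ) 1, ‖u (y + (2 * r) • w) - u y‖ₑ := by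
    have h1 := lintegral_scale hm x hr0
    have h2 := lintegral_scale hm y (by positivity : 0 < 2 * r)
    have h3 : ∫⁻ z in Metric.closedBall x r, ‖u z - u y‖ₑ
        ≤ ∫⁻ z in Metric.closedBall y (2 * r), ‖u z - u y‖ₑ := by
      apply lintegral_mono_set
      apply Metric.closedBall_subset_closedBall'
      rw [dist_eq_norm]; linarith
    rw [h1, h2, show (2 * r) ^ 2 = r ^ 2 * 4 by ring, ENNReal.ofReal_mul (by positivity),
      mul_assoc, ENNReal.ofReal_ofNat] at h3
    exact (ENNReal.mul_le_mul_iff_right (by positivity) ENNReal.ofReal_ne_top).1 h3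
  have hmain : 4 * ‖u x - u y‖ₑ ≤ 8 * ENNReal.ofReal r * (gmax u x + gmax u y) := by
    calc 4 * ‖u x - u y‖ₑ = ∫⁻ w in Metric.closedBall (0 : ℝ × ℝ) 1, ‖u x - u y‖ₑ := by
          rw [setLIntegral_const, vol_closedBall2 _ zero_le_one]
          norm_num [mul_comm]
      _ ≤ ∫⁻ w in Metric.closedBall (0 : ℝ × ℝ) 1,
            (‖u (x + r • w) - u x‖ₑ + ‖u (x + r • w) - u y‖ₑ) := by
          apply lintegral_mono; intro w
          show ‖u x - u y‖ₑ ≤ ‖u (x + r • w) - u x‖ₑ + ‖u (x + r • w) - u y‖ₑ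
          rw [show u x - u y = (u (x + r • w) - u y) - (u (x + r • w) - u x) by abel]
          exact (enorm_sub_le (E := ℝ × ℝ)).trans (add_comm _ _).le
      _ = (∫⁻ w in Metric.closedBall (0 : ℝ × ℝ) 1, ‖u (x + r • w) - u x‖ₑ) +
            ∫⁻ w in Metric.closedBall (0 : ℝ × ℝ) 1, ‖u (x + r • w) - u y‖ₑ := by
          rw [lintegral_add_left]
          exact ((hu.comp (by fun_prop)).sub_const _).enorm
      _ ≤ ENNReal.ofReal r * gmax u x + 4 * (ENNReal.ofReal (2 * r) * gmax u y) := by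
          gcongr
          exact hJ.trans (by gcongr)
      _ ≤ 8 * ENNReal.ofReal r * gmax u x + 8 * ENNReal.ofReal r * gmax u y := by
          refine add_le_add ?_ (le_of_eq ?_)
          · gcongr
            calc ENNReal.ofReal r = 1 * ENNReal.ofReal r := (one_mul _).symm
              _ ≤ _ := by gcongr; norm_num
          · rw [ENNReal.ofReal_mul (by norm_num), ENNReal.ofReal_ofNat, ← mul_assoc, ← mul_assoc]
            norm_num
      _ = _ := by ring
  have hre : ENNReal.ofReal r ≤ 2 * ‖x - y‖ₑ := by
    rw [← ofReal_norm, ← ENNReal.ofReal_ofNat, ← ENNReal.ofReal_mul (by norm_num)]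
    exact ENNReal.ofReal_le_ofReal hrle
  have h4 : 4 * ‖u x - u y‖ₑ ≤ 4 * (4 * ‖x - y‖ₑ * (gmax u x + gmax u y)) := by
    calc _ ≤ 8 * ENNReal.ofReal r * (gmax u x + gmax u y) := hmain
      _ ≤ 8 * (2 * ‖x - y‖ₑ) * (gmax u x + gmax u y) := by gcongr
      _ = _ := by ring
  exact (ENNReal.mul_le_mul_iff_right (by norm_num) (by norm_num)).1 h4

lemma gmax_ineq {u : ℝ × ℝ → ℝ × ℝ} (hu : Measurable u) (hper : ZZper u) (x y : ℝ × ℝ) :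
    ‖u x - u y‖ₑ ≤ 4 * ‖x - y‖ₑ * (gmax u x + gmax u y) := by
  set m := round (x.1 - y.1)
  set n := round (x.2 - y.2)
  have h := gmax_near hu x (y + ((m : ℝ), (n : ℝ))) (by
    rw [Prod.norm_def]
    refine max_le ?_ ?_
    · have := abs_sub_round (x.1 - y.1)
      simp only [Prod.fst_sub, Prod.fst_add, Real.norm_eq_abs]
      rwa [← sub_sub]
    · have := abs_sub_round (x.2 - y.2)
      simp only [Prod.snd_sub, Prod.snd_add, Real.norm_eq_abs]
      rwa [← sub_sub])
  rw [hper, gmax_per hper] at h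
  refine h.trans ?_
  gcongr
  rw [enorm_le_iff_norm_le, Prod.norm_def, Prod.norm_def]
  refine max_le_max ?_ ?_
  · have := round_le (x.1 - y.1) 0
    simp only [Prod.fst_sub, Prod.fst_add, Real.norm_eq_abs]
    rw [← sub_sub]; simpa using this
  · have := round_le (x.2 - y.2) 0
    simp only [Prod.snd_sub, Prod.snd_add, Real.norm_eq_abs]
    rw [← sub_sub]; simpa using this

lemma lintegral_big {f : ℝ × ℝ → ℝ≥0∞} (hper : ZZper f) :
    ∫⁻ x in Set.Icc ((-1 : ℝ), (-1 : ℝ)) (2, 2), f x ≤ 9 * ∫⁻ x, f x ∂μT := by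
  set Q := Set.Icc ((0:ℝ), (0:ℝ)) (1, 1) with hQ
  let c : Fin 3 × Fin 3 → ℝ × ℝ := fun i => ((((i.1 : ℕ) : ℤ) - 1 : ℤ), (((i.2 : ℕ) : ℤ) - 1 : ℤ))
  have hcover : Set.Icc ((-1 : ℝ), (-1 : ℝ)) (2, 2) ⊆ ⋃ i, (fun x => x + (- c i)) ⁻¹' Q := by
    have aux : ∀ a : ℝ, -1 ≤ a → a ≤ 2 → ∃ i : Fin 3, ((((i : ℕ) : ℤ) - 1 : ℤ) : ℝ) ≤ a ∧
        a ≤ ((((i : ℕ) : ℤ) - 1 : ℤ) : ℝ) + 1 := by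
      intro a h1 h2
      rcases le_total a 0 with h | h
      · exact ⟨0, by norm_num; linarith, by norm_num; linarith⟩
      · rcases le_total a 1 with h' | h'
        · exact ⟨1, by norm_num; linarith, by norm_num; linarith⟩
        · exact ⟨2, by norm_num; linarith, by norm_num; linarith⟩
    rintro ⟨a, b⟩ ⟨⟨h1, h2⟩, h3, h4⟩
    obtain ⟨i, hi1, hi2⟩ := aux a h1 h3
    obtain ⟨j, hj1, hj2⟩ := aux b h2 h4
    refine Set.mem_iUnion.2 ⟨(i, j), ?_⟩
    simp only [Set.mem_preimage, hQ, c]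
    refine ⟨⟨?_, ?_⟩, ?_, ?_⟩ <;> simp only [Prod.fst_add, Prod.snd_add, Prod.fst_neg, Prod.snd_neg] <;> linarith
  have hone : ∀ i, ∫⁻ x in (fun x => x + (- c i)) ⁻¹' Q, f x = ∫⁻ x, f x ∂μT := by
    intro i
    have hQm : MeasurableSet Q := measurableSet_Icc
    have hp : ∀ x, f (x + (- c i)) = f x := by
      intro x
      have := hper (x + (- c i)) (((i.1 : ℕ) : ℤ) - 1) (((i.2 : ℕ) : ℤ) - 1)
      rw [← this]
      congr 1
      show x + -c i + c i = x
      abel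
    rw [μT, ← lintegral_indicator (hQm.preimage (measurable_add_const _)), ← lintegral_indicator hQm,
      ← lintegral_add_right_eq_self (Q.indicator f) (- c i)]
    congr 1; ext x
    by_cases hx : x + (- c i) ∈ Q
    · rw [Set.indicator_of_mem hx, Set.indicator_of_mem (by exact hx), hp]
    · rw [Set.indicator_of_notMem hx, Set.indicator_of_notMem (by exact hx)]
  calc _ ≤ ∫⁻ x in ⋃ i, (fun x => x + (- c i)) ⁻¹' Q, f x := lintegral_mono_set hcover
    _ ≤ ∑' i, ∫⁻ x in (fun x => x + (- c i)) ⁻¹' Q, f x := lintegral_iUnion_le _ _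
    _ = 9 * ∫⁻ x, f x ∂μT := by
      simp_rw [hone]
      rw [tsum_fintype]
      simp only [Finset.sum_const, Finset.card_univ, Fintype.card_prod, Fintype.card_fin, nsmul_eq_mul]
      norm_num

lemma weak_type {f : ℝ × ℝ → ℝ≥0∞} (hf : Measurable f) (hper : ZZper f) {a : ℝ≥0∞}
    {S : Set (ℝ × ℝ)} (hS : S ⊆ Set.Icc ((0:ℝ), (0:ℝ)) (1, 1))
    (h : ∀ x ∈ S, ∃ ρ : ℝ, 0 < ρ ∧ ρ ≤ 1 ∧
      a ≤ ∫⁻ w in Metric.closedBall (0 : ℝ × ℝ) 1, f (x + ρ • w)) :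
    a * volume S ≤ 900 * ∫⁻ x, f x ∂μT := by
  choose! ρ hρ0 hρ1 hρ using h
  obtain ⟨V, hVS, hVd, hVc⟩ := Vitali.exists_disjoint_subfamily_covering_enlargement_closedBall
    S (fun x => x) ρ 1 hρ1 5 (by norm_num)
  have hVcount : V.Countable := by
    apply hVd.countable_of_nonempty_interior
    intro b hb
    exact ⟨b, mem_interior_iff_mem_nhds.2 (Metric.closedBall_mem_nhds b (hρ0 b (hVS hb)))⟩
  have hcover : S ⊆ ⋃ b ∈ V, Metric.closedBall b (5 * ρ b) := by
    intro x hx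
    obtain ⟨b, hb, hsub⟩ := hVc x hx
    exact Set.mem_biUnion hb (hsub (Metric.mem_closedBall_self (hρ0 x hx).le))
  have hsub : (⋃ b ∈ V, Metric.closedBall b (ρ b)) ⊆ Set.Icc ((-1 : ℝ), (-1 : ℝ)) (2, 2) := by
    apply Set.iUnion₂_subset
    rintro b hb z hz
    have h1 := hS (hVS hb)
    have h2 := hρ1 b (hVS hb)
    rw [mem_closedBall_iff_norm, Prod.norm_def, max_le_iff, Real.norm_eq_abs, Real.norm_eq_abs,
      abs_le, abs_le] at hz
    obtain ⟨⟨h3, h4⟩, h5, h6⟩ := h1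
    simp only [Prod.fst_sub, Prod.snd_sub] at *
    refine ⟨⟨?_, ?_⟩, ?_, ?_⟩ <;> simp only <;> linarith
  have := hVcount.to_subtype
  calc a * volume S ≤ a * ∑' b : V, volume (Metric.closedBall (b : ℝ × ℝ) (5 * ρ b)) := by
        gcongr
        refine (measure_mono hcover).trans ?_
        exact measure_biUnion_le _ hVcount _
    _ = ∑' b : V, a * volume (Metric.closedBall (b : ℝ × ℝ) (5 * ρ b)) := ENNReal.tsum_mul_left.symm
    _ ≤ ∑' b : V, 100 * ∫⁻ z in Metric.closedBall (b : ℝ × ℝ) (ρ b), f z := by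
        refine ENNReal.tsum_le_tsum fun b => ?_
        have hb := hVS b.2
        have h0 := hρ0 b hb
        rw [vol_closedBall2 _ (by positivity), lintegral_scale hf _ h0,
          show 4 * (5 * ρ b) ^ 2 = 100 * (ρ b) ^ 2 by ring, ENNReal.ofReal_mul (by norm_num),
          ENNReal.ofReal_ofNat]
        calc a * (100 * ENNReal.ofReal (ρ b ^ 2)) = 100 * (ENNReal.ofReal (ρ b ^ 2) * a) := by ring
          _ ≤ _ := by gcongr; exact hρ b hb
    _ = 100 * ∫⁻ z in ⋃ b ∈ V, Metric.closedBall (b : ℝ × ℝ) (ρ b), f z := by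
        rw [ENNReal.tsum_mul_left, lintegral_biUnion hVcount (fun _ _ => measurableSet_closedBall) hVd]
    _ ≤ 100 * (9 * ∫⁻ x, f x ∂μT) := by
        gcongr
        exact (lintegral_mono_set hsub).trans (lintegral_big hper)
    _ = _ := by rw [← mul_assoc]; norm_num

lemma grad_bound {u : ℝ × ℝ → ℝ × ℝ} (hu : ContDiff ℝ 1 u) (x : ℝ × ℝ) {r : ℝ} (hr : 0 < r) :
    ∫⁻ w in Metric.closedBall (0 : ℝ × ℝ) 1, ‖u (x + r • w) - u x‖ₑ ≤
      ENNReal.ofReal r * ∫⁻ θ in Set.Ioc (0:ℝ) 1,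
        ∫⁻ w in Metric.closedBall (0 : ℝ × ℝ) 1, ‖fderiv ℝ u (x + (θ * r) • w)‖ₑ := by
  have hc : Continuous (fderiv ℝ u) := hu.continuous_fderiv (by norm_num)
  have hpt : ∀ w ∈ Metric.closedBall (0 : ℝ × ℝ) 1, ‖u (x + r • w) - u x‖ₑ ≤
      ENNReal.ofReal r * ∫⁻ θ in Set.Ioc (0:ℝ) 1, ‖fderiv ℝ u (x + (θ * r) • w)‖ₑ := by
    intro w hw
    have hd : ∀ θ : ℝ, HasDerivAt (fun θ : ℝ => u (x + (θ * r) • w))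
        (fderiv ℝ u (x + (θ * r) • w) (r • w)) θ := by
      intro θ
      have h1 : HasDerivAt (fun θ : ℝ => x + (θ * r) • w) (r • w) θ := by
        have := (((hasDerivAt_id θ).mul_const r).smul_const w).const_add x
        simpa using this
      exact ((hu.differentiable (by norm_num)) _).hasFDerivAt.comp_hasDerivAt θ h1
    have hcont : Continuous fun θ : ℝ => fderiv ℝ u (x + (θ * r) • w) (r • w) := by fun_prop
    have h2 := intervalIntegral.integral_eq_sub_of_hasDerivAt (a := 0) (b := 1)
      (fun θ _ => hd θ) (hcont.intervalIntegrable _ _)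
    simp only [one_mul, zero_mul, zero_smul, add_zero] at h2
    rw [← h2, intervalIntegral.integral_of_le zero_le_one]
    refine (enorm_integral_le_lintegral_enorm _).trans ?_
    rw [← lintegral_const_mul _ (by fun_prop)]
    apply lintegral_mono; intro θ
    refine (ContinuousLinearMap.le_opENorm _ _).trans ?_
    rw [mul_comm]
    refine mul_le_mul' ?_ le_rfl
    rw [enorm_smul, Real.enorm_of_nonneg hr.le]
    calc _ ≤ ENNReal.ofReal r * 1 := by
          gcongr
          rw [mem_closedBall_zero_iff] at hw
          rw [← ofReal_norm, ← ENNReal.ofReal_one]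
          exact ENNReal.ofReal_le_ofReal hw
      _ = _ := mul_one _
  calc _ ≤ ∫⁻ w in Metric.closedBall (0 : ℝ × ℝ) 1,
        ENNReal.ofReal r * ∫⁻ θ in Set.Ioc (0:ℝ) 1, ‖fderiv ℝ u (x + (θ * r) • w)‖ₑ := by
        apply setLIntegral_mono' measurableSet_closedBall hpt
    _ = _ := by
      rw [lintegral_const_mul' _ _ ENNReal.ofReal_ne_top]
      congr 1
      apply lintegral_lintegral_swap
      apply Measurable.aemeasurable
      apply Measurable.enorm
      have hcc : Continuous (fun q : (ℝ × ℝ) × ℝ => fderiv ℝ u (x + (q.2 * r) • q.1)) := by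
        fun_prop
      exact hcc.measurable

lemma exists_rad {u : ℝ × ℝ → ℝ × ℝ} (hu : ContDiff ℝ 1 u) (x : ℝ × ℝ) {a : ℝ≥0∞}
    (ha : a < gmax u x) : ∃ ρ : ℝ, 0 < ρ ∧ ρ ≤ 1 ∧
      a ≤ ∫⁻ w in Metric.closedBall (0 : ℝ × ℝ) 1, ‖fderiv ℝ u (x + ρ • w)‖ₑ := by
  by_contra! hcon
  obtain ⟨k, hk⟩ := lt_iSup_iff.1 ha
  refine absurd hk (not_lt.2 ?_)
  have hr : 0 < (1 / 2 : ℝ) ^ k := by positivity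
  have hr1 : (1 / 2 : ℝ) ^ k ≤ 1 := pow_le_one₀ (by norm_num) (by norm_num)
  calc _ ≤ ENNReal.ofReal (2 ^ k) * (ENNReal.ofReal ((1 / 2 : ℝ) ^ k) *
      ∫⁻ θ in Set.Ioc (0:ℝ) 1, a) := by
        gcongr
        refine (grad_bound hu x hr).trans ?_
        refine mul_le_mul' le_rfl (setLIntegral_mono' measurableSet_Ioc ?_)
        intro θ hθ
        exact (hcon (θ * (1 / 2 : ℝ) ^ k) (mul_pos hθ.1 hr)
          (mul_le_one₀ hθ.2 hr.le hr1)).le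
    _ = a := by
      rw [← mul_assoc, ← ENNReal.ofReal_mul (by positivity), ← mul_pow]
      norm_num

lemma holder_ball {f : ℝ × ℝ → ℝ≥0∞} (hf : Measurable f) {p : ℝ} (hp : 1 < p) :
    (∫⁻ w in Metric.closedBall (0 : ℝ × ℝ) 1, f w) ^ p ≤
      4 ^ p * ∫⁻ w in Metric.closedBall (0 : ℝ × ℝ) 1, f w ^ p := by
  have hpq := Real.HolderConjugate.conjExponent hp
  have h1 := ENNReal.lintegral_mul_le_Lp_mul_Lq
    (volume.restrict (Metric.closedBall (0 : ℝ × ℝ) 1)) hpq hf.aemeasurable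
    (g := fun _ => 1) aemeasurable_const
  simp only [Pi.mul_apply, mul_one, ENNReal.one_rpow, setLIntegral_one,
    vol_closedBall2 _ zero_le_one] at h1
  have h2 : ENNReal.ofReal (4 * 1 ^ 2) ^ (1 / p.conjExponent) ≤ 4 := by
    rw [one_pow, mul_one, ENNReal.ofReal_ofNat]
    calc (4:ℝ≥0∞) ^ (1 / p.conjExponent) ≤ 4 ^ (1:ℝ) := by
          apply ENNReal.rpow_le_rpow_of_exponent_le (by norm_num)
          have := hpq.symm.lt
          rw [div_le_one (by linarith)]; exact this.le
      _ = 4 := ENNReal.rpow_one _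
  have hp0 : 0 < p := by linarith
  calc _ ≤ ((∫⁻ w in Metric.closedBall (0 : ℝ × ℝ) 1, f w ^ p) ^ (1 / p) * 4) ^ p := by
        gcongr
        exact h1.trans (by gcongr)
    _ = _ := by
      rw [ENNReal.mul_rpow_of_nonneg _ _ hp0.le, ← ENNReal.rpow_mul, one_div,
        inv_mul_cancel₀ hp0.ne', ENNReal.rpow_one, mul_comm]

lemma fderiv_per {u : ℝ × ℝ → ℝ × ℝ} (hper : ZZper u) : ZZper (fderiv ℝ u) := by
  intro x m n
  rw [← fderiv_comp_add_right]
  congr 1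
  ext1 y
  exact hper y m n

instance : IsProbabilityMeasure μT := by
  constructor
  rw [μT, Measure.restrict_apply_univ, ← Set.Icc_prod_Icc, Measure.volume_eq_prod,
    Measure.prod_prod]
  simp

lemma gmax_meas1 {u : ℝ × ℝ → ℝ × ℝ} (hu : Measurable u) : Measurable (gmax u) := by
  have := gmax_measurable (u := fun _ => u) (hu.comp measurable_snd)
  exact this.comp (f := fun x : ℝ × ℝ => ((0 : ℝ), x)) (by fun_prop)

lemma lintegral_fderiv {u : ℝ × ℝ → ℝ × ℝ} (hu : ContDiff ℝ 1 u) {p : ℝ} (hp : 1 < p) :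
    ∫⁻ x, ‖fderiv ℝ u x‖ₑ ^ p ∂μT = ENNReal.ofReal (∫ x, ‖fderiv ℝ u x‖ ^ p ∂μT) := by
  have hc : Continuous (fderiv ℝ u) := hu.continuous_fderiv (by norm_num)
  have hp0 : 0 ≤ p := by linarith
  rw [ofReal_integral_eq_lintegral_ofReal]
  · congr 1; ext x
    rw [← ENNReal.ofReal_rpow_of_nonneg (norm_nonneg _) hp0, ofReal_norm]
  · apply ContinuousOn.integrableOn_compact isCompact_Icc
    exact (hc.norm.rpow_const (fun _ => Or.inr hp0)).continuousOn
  · exact Filter.Eventually.of_forall fun x => by positivity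

lemma gmax_weak {u : ℝ × ℝ → ℝ × ℝ} (hu : ContDiff ℝ 1 u) (hper : ZZper u) {p : ℝ} (hp : 1 < p)
    {t : ℝ} (ht : 0 < t) :
    μT {x | ENNReal.ofReal t < gmax u x} ≤
      ENNReal.ofReal (900 * 4 ^ p * (∫ x, ‖fderiv ℝ u x‖ ^ p ∂μT) * t ^ (-p)) := by
  have hc : Continuous (fderiv ℝ u) := hu.continuous_fderiv (by norm_num)
  have hp0 : 0 < p := by linarith
  have hI : 0 ≤ ∫ x, ‖fderiv ℝ u x‖ ^ p ∂μT := integral_nonneg fun x => by positivity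
  set S := {x | ENNReal.ofReal t < gmax u x} ∩ Set.Icc ((0:ℝ), (0:ℝ)) (1, 1) with hS
  have hfm : Measurable fun x => ‖fderiv ℝ u x‖ₑ := hc.measurable.enorm
  have h1 : μT {x | ENNReal.ofReal t < gmax u x} = volume S := by
    rw [μT, Measure.restrict_apply]
    exact measurableSet_lt measurable_const (gmax_meas1 hu.continuous.measurable)
  have h2 := weak_type (f := fun x => ‖fderiv ℝ u x‖ₑ ^ p) (hfm.pow_const p)
    (fun x m n => by simp only [fderiv_per hper x m n]) (a := ENNReal.ofReal ((t / 4) ^ p))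
    (S := S) Set.inter_subset_right (by
      rintro x ⟨hx, -⟩
      obtain ⟨ρ, h0, h1, hρ⟩ := exists_rad hu x hx
      refine ⟨ρ, h0, h1, ?_⟩
      have h3 := holder_ball (f := fun w => ‖fderiv ℝ u (x + ρ • w)‖ₑ)
        (hfm.comp (by fun_prop)) hp
      have h4 := (ENNReal.rpow_le_rpow hρ hp0.le).trans h3
      have h5 : ENNReal.ofReal t ^ p = 4 ^ p * ENNReal.ofReal ((t / 4) ^ p) := by
        rw [ENNReal.ofReal_rpow_of_nonneg ht.le hp0.le, ← ENNReal.ofReal_ofNat 4,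
          ENNReal.ofReal_rpow_of_nonneg (by norm_num) hp0.le, ← ENNReal.ofReal_mul (by positivity),
          ← Real.mul_rpow (by norm_num) (by positivity)]
        congr 2; ring
      rw [h5] at h4
      refine (ENNReal.mul_le_mul_iff_right ?_ ?_).1 h4
      · exact (ENNReal.rpow_pos (by norm_num) (by norm_num)).ne'
      · exact ENNReal.rpow_ne_top_of_nonneg hp0.le (by norm_num))
  rw [lintegral_fderiv hu hp] at h2
  rw [h1]
  have hpos : 0 < (t / 4) ^ p := by positivity
  have h6 : ENNReal.ofReal ((t / 4) ^ p) * volume S ≤ ENNReal.ofReal ((t / 4) ^ p) *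
      ENNReal.ofReal (900 * 4 ^ p * (∫ x, ‖fderiv ℝ u x‖ ^ p ∂μT) * t ^ (-p)) := by
    refine h2.trans (le_of_eq ?_)
    rw [← ENNReal.ofReal_mul hpos.le, ← ENNReal.ofReal_ofNat, ← ENNReal.ofReal_mul (by norm_num)]
    congr 1
    rw [Real.div_rpow ht.le (by norm_num), Real.rpow_neg ht.le]
    have : 0 < t ^ p := by positivity
    field_simp
  exact (ENNReal.mul_le_mul_iff_right (by simpa using hpos) ENNReal.ofReal_ne_top).1 h6

lemma gmax_finite {u : ℝ × ℝ → ℝ × ℝ} (hu : ContDiff ℝ 1 u) (x : ℝ × ℝ) : gmax u x ≠ ⊤ := by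
  have hc : Continuous (fderiv ℝ u) := hu.continuous_fderiv (by norm_num)
  obtain ⟨L, hL⟩ := (isCompact_closedBall x 1).exists_bound_of_continuousOn hc.continuousOn
  intro htop
  obtain ⟨ρ, h0, h1, hρ⟩ := exists_rad hu x (a := ENNReal.ofReal L * 4 + 1) (by
    rw [htop]
    exact ENNReal.add_lt_top.2 ⟨ENNReal.mul_lt_top ENNReal.ofReal_lt_top (by norm_num),
      ENNReal.one_lt_top⟩)
  have h2 : ∫⁻ w in Metric.closedBall (0 : ℝ × ℝ) 1, ‖fderiv ℝ u (x + ρ • w)‖ₑ ≤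
      ENNReal.ofReal L * 4 := by
    calc _ ≤ ∫⁻ w in Metric.closedBall (0 : ℝ × ℝ) 1, ENNReal.ofReal L := by
          apply setLIntegral_mono' measurableSet_closedBall
          intro w hw
          rw [← ofReal_norm]
          apply ENNReal.ofReal_le_ofReal
          apply hL
          rw [mem_closedBall_zero_iff] at hw
          rw [mem_closedBall_iff_norm, add_sub_cancel_left, norm_smul, Real.norm_of_nonneg h0.le]
          exact mul_le_one₀ h1 (norm_nonneg _) hw
      _ = _ := by
          rw [setLIntegral_const, vol_closedBall2 _ zero_le_one]; norm_num
  have h3 := hρ.trans h2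
  have h4 : ENNReal.ofReal L * 4 < ENNReal.ofReal L * 4 + 1 :=
    ENNReal.lt_add_right (ENNReal.mul_ne_top ENNReal.ofReal_ne_top (by norm_num)) one_ne_zero
  exact absurd h4 (not_lt.2 h3)

lemma gmax_strong {u : ℝ × ℝ → ℝ × ℝ} (hu : ContDiff ℝ 1 u) (hper : ZZper u) {p : ℝ} (hp : 1 < p) :
    ∫⁻ x, gmax u x ∂μT ≤ ENNReal.ofReal ((1 + 900 * 4 ^ p / (p - 1)) *
      (∫ x, ‖fderiv ℝ u x‖ ^ p ∂μT) ^ p⁻¹) := by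
  have hp0 : 0 < p := by linarith
  have hI : 0 ≤ ∫ x, ‖fderiv ℝ u x‖ ^ p ∂μT := integral_nonneg fun x => by positivity
  have hw := fun t ht => gmax_weak hu hper hp (t := t) ht
  set I := ∫ x, ‖fderiv ℝ u x‖ ^ p ∂μT with hIdef
  set N := I ^ p⁻¹ with hN
  have hN0 : 0 ≤ N := by positivity
  have hNI : N ^ p = I := by rw [hN, ← Real.rpow_mul hI, inv_mul_cancel₀ hp0.ne', Real.rpow_one]
  have hm := gmax_meas1 hu.continuous.measurable
  have h1 : ∫⁻ x, gmax u x ∂μT = ∫⁻ t in Set.Ioi (0:ℝ), μT {x | t < (gmax u x).toReal} := by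
    rw [← lintegral_eq_lintegral_meas_lt]
    · congr 1; ext x
      rw [ENNReal.ofReal_toReal (gmax_finite hu x)]
    · exact Filter.Eventually.of_forall fun x => ENNReal.toReal_nonneg
    · exact hm.ennreal_toReal.aemeasurable
  have h2 : ∀ t ∈ Set.Ioi (0:ℝ), μT {x | t < (gmax u x).toReal} ≤
      ENNReal.ofReal (900 * 4 ^ p * I * t ^ (-p)) := by
    intro t ht
    refine le_trans (measure_mono ?_) (hw t ht)
    intro x hx
    exact (ENNReal.ofReal_lt_iff_lt_toReal (le_of_lt ht) (gmax_finite hu x)).2 hx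
  rw [h1]
  rcases hN0.eq_or_lt with hz | hpos
  · have hI0 : I = 0 := by rw [← hNI, ← hz, Real.zero_rpow hp0.ne']
    refine (setLIntegral_mono' measurableSet_Ioi h2).trans ?_
    simp [hI0]
  · rw [← Set.Ioc_union_Ioi_eq_Ioi hN0, lintegral_union measurableSet_Ioi
      (Set.disjoint_left.2 fun x hx hx' => not_lt.2 hx.2 hx')]
    have h3 : ∫⁻ t in Set.Ioc 0 N, μT {x | t < (gmax u x).toReal} ≤ ENNReal.ofReal N := by
      calc _ ≤ ∫⁻ t in Set.Ioc 0 N, 1 := lintegral_mono fun t => prob_le_one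
        _ = _ := by simp
    have h4 : ∫⁻ t in Set.Ioi N, μT {x | t < (gmax u x).toReal} ≤
        ENNReal.ofReal (900 * 4 ^ p / (p - 1) * N) := by
      calc _ ≤ ∫⁻ t in Set.Ioi N, ENNReal.ofReal (900 * 4 ^ p * I * t ^ (-p)) :=
            setLIntegral_mono' measurableSet_Ioi fun t ht => h2 t (hpos.trans ht)
        _ = ENNReal.ofReal (∫ t in Set.Ioi N, 900 * 4 ^ p * I * t ^ (-p)) := by
            rw [ofReal_integral_eq_lintegral_ofReal]
            · exact (integrableOn_Ioi_rpow_of_lt (by linarith) hpos).const_mul _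
            · filter_upwards [ae_restrict_mem measurableSet_Ioi] with t ht
              have : 0 < t := hpos.trans ht
              positivity
        _ = _ := by
            rw [integral_const_mul, integral_Ioi_rpow_of_lt (by linarith) hpos, ← hNI]
            congr 1
            rw [Real.rpow_add hpos, Real.rpow_neg hN0, Real.rpow_one]
            have h5 : 0 < N ^ p := by positivity
            have h6 : -p + 1 ≠ 0 := by linarith
            have h7 : p - 1 ≠ 0 := by linarith
            rw [show -p + 1 = -(p - 1) by ring]
            field_simp
    calc _ ≤ ENNReal.ofReal N + ENNReal.ofReal (900 * 4 ^ p / (p - 1) * N) := add_le_add h3 h4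
      _ = _ := by
        have : 0 < p - 1 := by linarith
        rw [← ENNReal.ofReal_add hN0 (by positivity)]
        congr 1; ring

lemma dT2_bdd (a b : ℝ × ℝ) : BddBelow (Set.range fun mn : ℤ × ℤ =>
    ‖a - b + (((mn.1 : ℝ), (mn.2 : ℝ)) : ℝ × ℝ)‖) :=
  ⟨0, by rintro _ ⟨mn, rfl⟩; exact norm_nonneg _⟩

lemma dT2_nonneg (a b : ℝ × ℝ) : 0 ≤ dT2 a b := Real.iInf_nonneg fun _ => norm_nonneg _

lemma dT2_le_norm (a b : ℝ × ℝ) : dT2 a b ≤ ‖a - b‖ := by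
  refine (ciInf_le (dT2_bdd a b) (0, 0)).trans (le_of_eq ?_)
  congr 1
  ext <;> simp

lemma dT2_le_one (a b : ℝ × ℝ) : dT2 a b ≤ 1 := by
  refine (ciInf_le (dT2_bdd a b) (- round (a.1 - b.1), - round (a.2 - b.2))).trans ?_
  rw [Prod.norm_def]
  refine max_le ?_ ?_
  · have := abs_sub_round (a.1 - b.1)
    simp only [Prod.fst_sub, Prod.fst_add, Real.norm_eq_abs, Int.cast_neg]
    rw [← sub_eq_add_neg]; linarith
  · have := abs_sub_round (a.2 - b.2)
    simp only [Prod.snd_sub, Prod.snd_add, Real.norm_eq_abs, Int.cast_neg]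
    rw [← sub_eq_add_neg]; linarith

lemma dT2_le_log (a b : ℝ × ℝ) {δ : ℝ} (hδ : 0 < δ) (hδ1 : δ < 1) :
    dT2 a b ≤ 2 / |Real.log δ| * (1 + Real.log (1 + ‖a - b‖ / δ)) := by
  have hL : 0 < |Real.log δ| := abs_pos.2 (Real.log_neg hδ hδ1).ne
  have hLe : |Real.log δ| = - Real.log δ := abs_of_neg (Real.log_neg hδ hδ1)
  have hs : 0 < √δ := Real.sqrt_pos.2 hδ
  have hlog : Real.log (√δ)⁻¹ = |Real.log δ| / 2 := by
    rw [Real.log_inv, Real.log_sqrt hδ.le, hLe]; ring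
  have hΦ : 0 ≤ Real.log (1 + ‖a - b‖ / δ) := by
    apply Real.log_nonneg
    have : 0 ≤ ‖a - b‖ / δ := by positivity
    linarith
  rw [div_mul_eq_mul_div, le_div_iff₀ hL]
  rcases le_total ‖a - b‖ (√δ) with h | h
  · have h1 := Real.log_le_sub_one_of_pos (inv_pos.2 hs)
    rw [hlog] at h1
    have h2 : dT2 a b ≤ √δ := (dT2_le_norm a b).trans h
    calc dT2 a b * |Real.log δ| ≤ √δ * (2 * (√δ)⁻¹) := by
          gcongr
          linarith
      _ = 2 := by field_simp
      _ ≤ _ := by linarith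
  · have h1 : (√δ)⁻¹ ≤ 1 + ‖a - b‖ / δ := by
      have : (√δ)⁻¹ = √δ / δ := by
        rw [eq_div_iff hδ.ne']
        nth_rewrite 2 [← Real.mul_self_sqrt hδ.le]
        field_simp
      rw [this]
      have : √δ / δ ≤ ‖a - b‖ / δ := by gcongr
      linarith
    have h2 := Real.log_le_log (inv_pos.2 hs) h1
    rw [hlog] at h2
    have h3 := dT2_le_one a b
    nlinarith

lemma flow_modif {t : ℝ} (ht : 0 ≤ t) {u X : ℝ → ℝ × ℝ → ℝ × ℝ} (hX : IsRegLagFlow t u X) :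
    ∃ Y : ℝ → ℝ × ℝ → ℝ × ℝ, Measurable (Function.uncurry Y) ∧
      ∀ᵐ x ∂μT, ∀ s ∈ Set.Icc (0:ℝ) t, Y s x = X s x := by
  obtain ⟨hm, hae, -⟩ := hX
  obtain ⟨G, hG, hGm, hGp⟩ := hae.exists_measurable_mem
  refine ⟨fun s => G.indicator (X (Set.projIcc 0 t ht s)), ?_, ?_⟩
  · apply measurable_uncurry_of_continuous_of_measurable
    · intro x
      by_cases hx : x ∈ G
      · simp only [Set.indicator_of_mem hx]
        obtain ⟨hi, heq⟩ := hGp x hx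
        have h1 : (fun s : ℝ => X (Set.projIcc 0 t ht s) x) =
            fun s => x + ∫ τ in t..(Set.projIcc 0 t ht s : ℝ), u τ (X τ x) := by
          ext1 s
          rw [heq _ (Set.projIcc 0 t ht s).2, intervalIntegral.integral_symm, sub_neg_eq_add]
        rw [h1]
        have h2 := intervalIntegral.continuousOn_primitive_interval' hi (a := t) (by simp)
        rw [Set.uIcc_of_le ht] at h2
        exact continuous_const.add (h2.comp_continuous
          (continuous_subtype_val.comp continuous_projIcc) fun s => (Set.projIcc 0 t ht s).2)
      · simp only [Set.indicator_of_notMem hx]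
        exact continuous_const
    · intro s
      exact (hm _).indicator hGm
  · filter_upwards [hG] with x hx s hs
    rw [Set.indicator_of_mem hx, Set.projIcc_of_mem ht hs]

lemma flow_lintegral {t : ℝ} {u X Y : ℝ → ℝ × ℝ → ℝ × ℝ} (hX : IsRegLagFlow t u X)
    (hY : Measurable (Function.uncurry Y))
    (hXY : ∀ᵐ x ∂μT, ∀ s ∈ Set.Icc (0:ℝ) t, Y s x = X s x)
    {F : ℝ → ℝ × ℝ → ℝ≥0∞} (hF : Measurable (fun q : ℝ × (ℝ × ℝ) => F q.1 q.2))
    (hper : ∀ s, ZZper (F s)) :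
    ∫⁻ x, (∫⁻ τ in Set.Ioc 0 t, F τ (Y τ x)) ∂μT = ∫⁻ τ in Set.Ioc 0 t, ∫⁻ x, F τ x ∂μT := by
  rw [lintegral_lintegral_swap]
  · apply setLIntegral_congr_fun measurableSet_Ioc
    intro τ hτ
    have hτ' : τ ∈ Set.Icc 0 t := ⟨hτ.1.le, hτ.2⟩
    simp only
    rw [← hX.2.2 τ hτ' (F τ) (hF.comp measurable_prodMk_left) (hper τ)]
    apply lintegral_congr_ae
    filter_upwards [hXY] with x hx
    rw [hx τ hτ']
  · apply Measurable.aemeasurable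
    exact hF.comp (f := fun q : (ℝ × ℝ) × ℝ => (q.2, Y q.2 q.1))
      (measurable_snd.prodMk (hY.comp measurable_swap))

lemma delta_eq {T : ℝ} (hT : 0 ≤ T) {u₁ u₂ : ℝ → ℝ × ℝ → ℝ × ℝ}
    (h1 : Integrable (fun q : ℝ × (ℝ × ℝ) => u₁ q.1 q.2)
          ((volume.restrict (Set.Ioc 0 T)).prod μT))
    (h2 : Integrable (fun q : ℝ × (ℝ × ℝ) => u₂ q.1 q.2)
          ((volume.restrict (Set.Ioc 0 T)).prod μT)) :
    ∫⁻ τ in Set.Ioc 0 T, ∫⁻ x, ‖u₁ τ x - u₂ τ x‖ₑ ∂μT =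
      ENNReal.ofReal (∫ s in (0:ℝ)..T, ∫ x, ‖u₁ s x - u₂ s x‖ ∂μT) := by
  have h := (h1.sub h2)
  have h3 : Integrable (fun q : ℝ × (ℝ × ℝ) => ‖u₁ q.1 q.2 - u₂ q.1 q.2‖)
          ((volume.restrict (Set.Ioc 0 T)).prod μT) := h.norm
  rw [intervalIntegral.integral_of_le hT,
    ← integral_prod (fun q : ℝ × (ℝ × ℝ) => ‖u₁ q.1 q.2 - u₂ q.1 q.2‖) h3,
    ofReal_integral_eq_lintegral_ofReal h3 (Filter.Eventually.of_forall fun _ => norm_nonneg _),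
    lintegral_prod _ h3.aestronglyMeasurable.aemeasurable.ennreal_ofReal]
  simp_rw [ofReal_norm]

lemma phi_pointwise {s t δ : ℝ} (hs : s ∈ Set.Icc 0 t) (hδ : 0 < δ)
    {u₁ u₂ X₁ X₂ : ℝ → ℝ × ℝ → ℝ × ℝ}
    (hm1 : Measurable (fun q : ℝ × (ℝ × ℝ) => u₁ q.1 q.2)) (hp1 : ∀ s, ZZper (u₁ s)) {x : ℝ × ℝ}
    (h1 : IntervalIntegrable (fun τ => u₁ τ (X₁ τ x)) MeasureTheory.volume 0 t ∧
      ∀ s ∈ Set.Icc (0:ℝ) t, X₁ s x = x - ∫ τ in s..t, u₁ τ (X₁ τ x))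
    (h2 : IntervalIntegrable (fun τ => u₂ τ (X₂ τ x)) MeasureTheory.volume 0 t ∧
      ∀ s ∈ Set.Icc (0:ℝ) t, X₂ s x = x - ∫ τ in s..t, u₂ τ (X₂ τ x)) :
    ENNReal.ofReal (Real.log (1 + ‖X₁ s x - X₂ s x‖ / δ)) ≤
      ∫⁻ τ in Set.Ioc 0 t, (4 * gmax (u₁ τ) (X₁ τ x) + (4 * gmax (u₁ τ) (X₂ τ x) +
        ENNReal.ofReal δ⁻¹ * ‖u₁ τ (X₂ τ x) - u₂ τ (X₂ τ x)‖ₑ)) := by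
  obtain ⟨i1, e1⟩ := h1
  obtain ⟨i2, e2⟩ := h2
  have ht : 0 ≤ t := hs.1.trans hs.2
  have hsub : ∀ r ∈ Set.Icc 0 t, Set.uIcc r t ⊆ Set.uIcc 0 t := by
    intro r hr
    rw [Set.uIcc_of_le hr.2, Set.uIcc_of_le ht]
    exact Set.Icc_subset_Icc_left hr.1
  have h := log_gronwall (s := s) (t := t) (δ := δ) hs.2 hδ
    (h := fun τ => ‖u₁ τ (X₁ τ x) - u₂ τ (X₂ τ x)‖) (D := fun r => ‖X₁ r x - X₂ r x‖)
    (fun _ => norm_nonneg _) ((i1.sub i2).mono_set (hsub s hs)).norm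
    (fun _ _ => norm_nonneg _) (by
      intro r hr
      have hr' : r ∈ Set.Icc 0 t := ⟨hs.1.trans hr.1, hr.2⟩
      rw [e1 r hr', e2 r hr', sub_sub_sub_cancel_left, ← intervalIntegral.integral_sub
        (i2.mono_set (hsub r hr')) (i1.mono_set (hsub r hr'))]
      refine (intervalIntegral.norm_integral_le_integral_norm hr.2).trans (le_of_eq ?_)
      simp_rw [norm_sub_rev])
  refine h.trans ?_
  refine (lintegral_mono fun τ => ?_).trans (lintegral_mono_set (Set.Ioc_subset_Ioc_left hs.1))
  have hD : 0 < δ + ‖X₁ τ x - X₂ τ x‖ := by positivity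
  rw [ENNReal.ofReal_div_of_pos hD]
  apply ENNReal.div_le_of_le_mul
  rw [ofReal_norm]
  have hu1 : Measurable (u₁ τ) := hm1.comp measurable_prodMk_left
  have hg := gmax_ineq hu1 (hp1 τ) (X₁ τ x) (X₂ τ x)
  set g1 := gmax (u₁ τ) (X₁ τ x)
  set g2 := gmax (u₁ τ) (X₂ τ x)
  set e := ‖u₁ τ (X₂ τ x) - u₂ τ (X₂ τ x)‖ₑ with he
  have hDe : ‖X₁ τ x - X₂ τ x‖ₑ ≤ ENNReal.ofReal (δ + ‖X₁ τ x - X₂ τ x‖) := by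
    rw [← ofReal_norm]; exact ENNReal.ofReal_le_ofReal (by linarith)
  have hδe : 1 ≤ ENNReal.ofReal δ⁻¹ * ENNReal.ofReal (δ + ‖X₁ τ x - X₂ τ x‖) := by
    rw [← ENNReal.ofReal_mul (by positivity), ← ENNReal.ofReal_one]
    apply ENNReal.ofReal_le_ofReal
    rw [mul_add, inv_mul_cancel₀ hδ.ne']
    have : 0 ≤ δ⁻¹ * ‖X₁ τ x - X₂ τ x‖ := by positivity
    linarith
  set M := ENNReal.ofReal (δ + ‖X₁ τ x - X₂ τ x‖)
  calc ‖u₁ τ (X₁ τ x) - u₂ τ (X₂ τ x)‖ₑ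
      ≤ ‖u₁ τ (X₁ τ x) - u₁ τ (X₂ τ x)‖ₑ + e := by
        rw [← sub_add_sub_cancel (u₁ τ (X₁ τ x)) (u₁ τ (X₂ τ x)) (u₂ τ (X₂ τ x))]
        exact enorm_add_le _ _
    _ ≤ 4 * M * (g1 + g2) + (ENNReal.ofReal δ⁻¹ * M) * e := by
        refine add_le_add (hg.trans (by gcongr)) ?_
        calc e = 1 * e := (one_mul _).symm
          _ ≤ _ := by gcongr
    _ = _ := by ring
lemma meas_slice {F : ℝ → ℝ × ℝ → ℝ≥0∞} (hF : Measurable (fun q : ℝ × (ℝ × ℝ) => F q.1 q.2))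
    (τ : ℝ) : Measurable (F τ) := hF.comp measurable_prodMk_left

set_option maxHeartbeats 1000000 in
lemma phi_bound {p : ℝ} (hp : 1 < p) {T t s δ K : ℝ} (hT : 0 < T) (ht : t ∈ Set.Icc (0:ℝ) T)
    (hs : s ∈ Set.Icc (0:ℝ) t) (hK : K = 1 + 900 * 4 ^ p / (p - 1))
    {u₁ u₂ X₁ X₂ : ℝ → ℝ × ℝ → ℝ × ℝ}
    (hm1 : Measurable (fun q : ℝ × (ℝ × ℝ) => u₁ q.1 q.2))
    (hm2 : Measurable (fun q : ℝ × (ℝ × ℝ) => u₂ q.1 q.2))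
    (hp1 : ∀ s, ZZper (u₁ s)) (hp2 : ∀ s, ZZper (u₂ s))
    (hi1 : Integrable (fun q : ℝ × (ℝ × ℝ) => u₁ q.1 q.2)
          ((volume.restrict (Set.Ioc 0 T)).prod μT))
    (hi2 : Integrable (fun q : ℝ × (ℝ × ℝ) => u₂ q.1 q.2)
          ((volume.restrict (Set.Ioc 0 T)).prod μT))
    (hc : ∀ᵐ s ∂volume.restrict (Set.Ioc (0:ℝ) T), ContDiff ℝ 1 (u₁ s))
    (hA : IntervalIntegrable
          (fun s => (∫ x, ‖fderiv ℝ (u₁ s) x‖ ^ p ∂μT) ^ p⁻¹) MeasureTheory.volume 0 T)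
    (hX1 : IsRegLagFlow t u₁ X₁) (hX2 : IsRegLagFlow t u₂ X₂)
    (hδd : δ = ∫ s in (0:ℝ)..T, ∫ x, ‖u₁ s x - u₂ s x‖ ∂μT) (hδ : 0 < δ) :
    ∫⁻ x, ENNReal.ofReal (Real.log (1 + ‖X₁ s x - X₂ s x‖ / δ)) ∂μT ≤
      ENNReal.ofReal (8 * K * (∫ s' in (0:ℝ)..T, (∫ x, ‖fderiv ℝ (u₁ s') x‖ ^ p ∂μT) ^ p⁻¹)
        + 1) := by
  obtain ⟨Y₁, hY1, hXY1⟩ := flow_modif ht.1 hX1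
  obtain ⟨Y₂, hY2, hXY2⟩ := flow_modif ht.1 hX2
  have hK0 : 0 ≤ K := by
    have : 0 < p - 1 := by linarith
    rw [hK]; positivity
  have hgm : Measurable (fun q : ℝ × (ℝ × ℝ) => gmax (u₁ q.1) q.2) := gmax_measurable hm1
  have hF1 : Measurable (fun q : ℝ × (ℝ × ℝ) => 4 * gmax (u₁ q.1) q.2) := hgm.const_mul 4
  have hE : Measurable (fun q : ℝ × (ℝ × ℝ) => ENNReal.ofReal δ⁻¹ * ‖u₁ q.1 q.2 - u₂ q.1 q.2‖ₑ) :=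
    (hm1.sub hm2).enorm.const_mul _
  have hF2 : Measurable (fun q : ℝ × (ℝ × ℝ) => 4 * gmax (u₁ q.1) q.2 +
      ENNReal.ofReal δ⁻¹ * ‖u₁ q.1 q.2 - u₂ q.1 q.2‖ₑ) := hF1.add hE
  have hgper : ∀ τ, ZZper (gmax (u₁ τ)) := fun τ => gmax_per (hp1 τ)
  have hper1 : ∀ τ, ZZper (fun y => 4 * gmax (u₁ τ) y) := by
    intro τ x m n
    simp only [hgper τ x m n]
  have hper2 : ∀ τ, ZZper (fun y => 4 * gmax (u₁ τ) y +
      ENNReal.ofReal δ⁻¹ * ‖u₁ τ y - u₂ τ y‖ₑ) := by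
    intro τ x m n
    simp only [hgper τ x m n, hp1 τ x m n, hp2 τ x m n]
  -- the bound of the maximal function part
  have hG : ∫⁻ τ in Set.Ioc 0 T, ∫⁻ x, gmax (u₁ τ) x ∂μT ≤
      ENNReal.ofReal (K * ∫ s' in (0:ℝ)..T, (∫ x, ‖fderiv ℝ (u₁ s') x‖ ^ p ∂μT) ^ p⁻¹) := by
    have hA' := (intervalIntegrable_iff_integrableOn_Ioc_of_le hT.le).1 hA
    rw [intervalIntegral.integral_of_le hT.le, ← integral_const_mul,
      ofReal_integral_eq_lintegral_ofReal (hA'.const_mul K)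
        (Filter.Eventually.of_forall fun τ => by dsimp only [Pi.zero_apply]; positivity)]
    refine lintegral_mono_ae ?_
    filter_upwards [hc] with τ hτ
    rw [hK]
    exact gmax_strong hτ (hp1 τ) hp
  have hstep : ∫⁻ x, ENNReal.ofReal (Real.log (1 + ‖X₁ s x - X₂ s x‖ / δ)) ∂μT ≤
      ∫⁻ x, ((∫⁻ τ in Set.Ioc 0 t, 4 * gmax (u₁ τ) (Y₁ τ x)) +
        ∫⁻ τ in Set.Ioc 0 t, (4 * gmax (u₁ τ) (Y₂ τ x) +
        ENNReal.ofReal δ⁻¹ * ‖u₁ τ (Y₂ τ x) - u₂ τ (Y₂ τ x)‖ₑ)) ∂μT := by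
    refine lintegral_mono_ae ?_
    filter_upwards [hX1.2.1, hX2.2.1, hXY1, hXY2] with x h1 h2 y1 y2
    refine (phi_pointwise hs hδ hm1 hp1 h1 h2).trans (le_of_eq ?_)
    rw [← lintegral_add_left]
    · refine setLIntegral_congr_fun measurableSet_Ioc ?_
      intro τ hτ
      have hτ' : τ ∈ Set.Icc 0 t := ⟨hτ.1.le, hτ.2⟩
      simp only [y1 τ hτ', y2 τ hτ']
    · exact hF1.comp (f := fun τ : ℝ => (τ, Y₁ τ x))
        (measurable_id.prodMk (hY1.comp measurable_prodMk_right))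
  refine hstep.trans ?_
  rw [lintegral_add_left]
  swap
  · exact Measurable.lintegral_prod_right' (f := fun q : (ℝ × ℝ) × ℝ =>
      4 * gmax (u₁ q.2) (Y₁ q.2 q.1))
      (hF1.comp (f := fun q : (ℝ × ℝ) × ℝ => (q.2, Y₁ q.2 q.1))
      (measurable_snd.prodMk (hY1.comp measurable_swap)))
  have f1 := flow_lintegral (F := fun τ y => 4 * gmax (u₁ τ) y) hX1 hY1 hXY1 hF1 hper1
  have f2 := flow_lintegral (F := fun τ y => 4 * gmax (u₁ τ) y +
      ENNReal.ofReal δ⁻¹ * ‖u₁ τ y - u₂ τ y‖ₑ) hX2 hY2 hXY2 hF2 hper2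
  rw [f1, f2]
  have hsub : Set.Ioc 0 t ⊆ Set.Ioc 0 T := Set.Ioc_subset_Ioc_right ht.2
  have hin : Measurable (fun τ : ℝ => ∫⁻ x, gmax (u₁ τ) x ∂μT) := hgm.lintegral_prod_right'
  have b1 : ∫⁻ τ in Set.Ioc 0 T, ∫⁻ x, 4 * gmax (u₁ τ) x ∂μT =
      4 * ∫⁻ τ in Set.Ioc 0 T, ∫⁻ x, gmax (u₁ τ) x ∂μT := by
    rw [← lintegral_const_mul _ hin]
    refine lintegral_congr fun τ => ?_
    have hh : Measurable fun x => gmax (u₁ τ) x := meas_slice (F := fun τ x => gmax (u₁ τ) x) hgm τ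
    exact lintegral_const_mul _ hh
  have b2 : ∫⁻ τ in Set.Ioc 0 T, ∫⁻ x, (4 * gmax (u₁ τ) x +
      ENNReal.ofReal δ⁻¹ * ‖u₁ τ x - u₂ τ x‖ₑ) ∂μT =
      4 * (∫⁻ τ in Set.Ioc 0 T, ∫⁻ x, gmax (u₁ τ) x ∂μT) + 1 := by
    have c1 : ∀ τ, ∫⁻ x, (4 * gmax (u₁ τ) x +
        ENNReal.ofReal δ⁻¹ * ‖u₁ τ x - u₂ τ x‖ₑ) ∂μT = (∫⁻ x, 4 * gmax (u₁ τ) x ∂μT) +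
        ENNReal.ofReal δ⁻¹ * ∫⁻ x, ‖u₁ τ x - u₂ τ x‖ₑ ∂μT := by
      intro τ
      have hh : Measurable fun x => 4 * gmax (u₁ τ) x := meas_slice (F := fun τ x => 4 * gmax (u₁ τ) x) hF1 τ
      rw [lintegral_add_left hh]
      congr 1
      apply lintegral_const_mul
      exact meas_slice (F := fun τ x => ‖u₁ τ x - u₂ τ x‖ₑ) (hm1.sub hm2).enorm τ
    simp_rw [c1]
    rw [lintegral_add_left, b1, lintegral_const_mul, delta_eq hT.le hi1 hi2, ← hδd,
      ← ENNReal.ofReal_mul (by positivity), inv_mul_cancel₀ hδ.ne', ENNReal.ofReal_one]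
    · exact (hm1.sub hm2).enorm.lintegral_prod_right'
    · exact hF1.lintegral_prod_right'
  refine (add_le_add (lintegral_mono_set hsub) (lintegral_mono_set hsub)).trans ?_
  rw [b1, b2]
  set A := ∫ s' in (0:ℝ)..T, (∫ x, ‖fderiv ℝ (u₁ s') x‖ ^ p ∂μT) ^ p⁻¹ with hAd
  have hA0 : 0 ≤ A := intervalIntegral.integral_nonneg hT.le fun τ _ => by positivity
  have hKA : 0 ≤ K * A := mul_nonneg hK0 hA0
  calc _ ≤ 4 * ENNReal.ofReal (K * A) + (4 * ENNReal.ofReal (K * A) + 1) := by gcongr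
    _ = ENNReal.ofReal (8 * K * A + 1) := by
      have e4 : (4 : ℝ≥0∞) = ENNReal.ofReal 4 := by norm_num
      rw [e4, ← ENNReal.ofReal_one, ← ENNReal.ofReal_mul (by norm_num),
        ← ENNReal.ofReal_add (by positivity) (by norm_num),
        ← ENNReal.ofReal_add (by positivity) (by positivity)]
      congr 1; ring

/-- quantitative stability of regular Lagrangian flows (case `p > 1`):
`∫_{𝕋²} d(X₁(s,x), X₂(s,x)) dx ≤ C (1 + A)/|log δ|` with
`A = ∫_0^T ‖∇_x u₁(s)‖_{L^p} ds` and `δ = ∫_0^T ‖u₁(s) − u₂(s)‖_{L¹} ds ≤ δ₀`. -/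
theorem stmt13 (p : ℝ) (hp : 1 < p) :
    ∃ δ₀ ∈ Set.Ioo (0:ℝ) 1, ∃ C : ℝ, 0 < C ∧
      ∀ T : ℝ, 0 < T → ∀ t ∈ Set.Icc (0:ℝ) T,
      ∀ u₁ u₂ X₁ X₂ : ℝ → ℝ × ℝ → ℝ × ℝ,
        Measurable (fun q : ℝ × (ℝ × ℝ) => u₁ q.1 q.2) →
        Measurable (fun q : ℝ × (ℝ × ℝ) => u₂ q.1 q.2) →
        (∀ s, ZZper (u₁ s)) → (∀ s, ZZper (u₂ s)) →
        Integrable (fun q : ℝ × (ℝ × ℝ) => u₁ q.1 q.2)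
          ((volume.restrict (Set.Ioc 0 T)).prod μT) →
        Integrable (fun q : ℝ × (ℝ × ℝ) => u₂ q.1 q.2)
          ((volume.restrict (Set.Ioc 0 T)).prod μT) →
        (∀ᵐ s ∂volume.restrict (Set.Ioc (0:ℝ) T), ContDiff ℝ 1 (u₁ s)) →
        IntervalIntegrable
          (fun s => (∫ x, ‖fderiv ℝ (u₁ s) x‖ ^ p ∂μT) ^ p⁻¹) MeasureTheory.volume 0 T →
        IsRegLagFlow t u₁ X₁ → IsRegLagFlow t u₂ X₂ →
        0 < (∫ s in (0:ℝ)..T, ∫ x, ‖u₁ s x - u₂ s x‖ ∂μT) →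
        (∫ s in (0:ℝ)..T, ∫ x, ‖u₁ s x - u₂ s x‖ ∂μT) ≤ δ₀ →
        ∀ s ∈ Set.Icc (0:ℝ) t,
          (∫ x, dT2 (X₁ s x) (X₂ s x) ∂μT)
            ≤ C * (1 + ∫ s' in (0:ℝ)..T, (∫ x, ‖fderiv ℝ (u₁ s') x‖ ^ p ∂μT) ^ p⁻¹)
                / |Real.log (∫ s' in (0:ℝ)..T, ∫ x, ‖u₁ s' x - u₂ s' x‖ ∂μT)| := by
  have hp0 : 0 < p - 1 := by linarith
  obtain ⟨K, hK⟩ : ∃ K : ℝ, K = 1 + 900 * 4 ^ p / (p - 1) := ⟨_, rfl⟩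
  have hK0 : 0 ≤ K := by rw [hK]; positivity
  refine ⟨1 / 2, by norm_num, 4 + 16 * K, by positivity, ?_⟩
  intro T hT t ht u₁ u₂ X₁ X₂ hm1 hm2 hp1 hp2 hi1 hi2 hc hA hX1 hX2 hδ hδ1 s hs
  obtain ⟨δ, hδd⟩ : ∃ δ : ℝ, δ = ∫ s in (0:ℝ)..T, ∫ x, ‖u₁ s x - u₂ s x‖ ∂μT := ⟨_, rfl⟩
  rw [← hδd] at hδ hδ1 ⊢
  have hΦ := phi_bound hp hT ht hs hK hm1 hm2 hp1 hp2 hi1 hi2 hc hA hX1 hX2 hδd hδ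
  have hA0 : 0 ≤ ∫ s' in (0:ℝ)..T, (∫ x, ‖fderiv ℝ (u₁ s') x‖ ^ p ∂μT) ^ p⁻¹ :=
    intervalIntegral.integral_nonneg hT.le fun τ _ => by positivity
  set A := ∫ s' in (0:ℝ)..T, (∫ x, ‖fderiv ℝ (u₁ s') x‖ ^ p ∂μT) ^ p⁻¹ with hAd
  have hδ1' : δ < 1 := by linarith
  have hL : 0 < |Real.log δ| := abs_pos.2 (Real.log_neg hδ hδ1').ne
  have hR : 0 ≤ (4 + 16 * K) * (1 + A) / |Real.log δ| := by positivity
  by_cases hint : Integrable (fun x => dT2 (X₁ s x) (X₂ s x)) μT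
  swap
  · rw [integral_undef hint]; exact hR
  rw [← ENNReal.ofReal_le_ofReal_iff hR, ofReal_integral_eq_lintegral_ofReal hint
    (Filter.Eventually.of_forall fun x => dT2_nonneg _ _)]
  have hmeas : Measurable fun x =>
      ENNReal.ofReal (Real.log (1 + ‖X₁ s x - X₂ s x‖ / δ)) := by
    have h1 := hX1.1 s
    have h2 := hX2.1 s
    fun_prop
  calc ∫⁻ x, ENNReal.ofReal (dT2 (X₁ s x) (X₂ s x)) ∂μT
      ≤ ∫⁻ x, ENNReal.ofReal (2 / |Real.log δ|) *
          (1 + ENNReal.ofReal (Real.log (1 + ‖X₁ s x - X₂ s x‖ / δ))) ∂μT := by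
        refine lintegral_mono fun x => ?_
        have hl : 0 ≤ Real.log (1 + ‖X₁ s x - X₂ s x‖ / δ) := by
          apply Real.log_nonneg
          have : 0 ≤ ‖X₁ s x - X₂ s x‖ / δ := by positivity
          linarith
        dsimp only
        rw [← ENNReal.ofReal_one, ← ENNReal.ofReal_add zero_le_one hl,
          ← ENNReal.ofReal_mul (by positivity)]
        exact ENNReal.ofReal_le_ofReal (dT2_le_log _ _ hδ hδ1')
    _ = ENNReal.ofReal (2 / |Real.log δ|) *
          (1 + ∫⁻ x, ENNReal.ofReal (Real.log (1 + ‖X₁ s x - X₂ s x‖ / δ)) ∂μT) := by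
        rw [lintegral_const_mul _ (hmeas.const_add 1),
          lintegral_add_left measurable_const, lintegral_one, measure_univ]
    _ ≤ ENNReal.ofReal (2 / |Real.log δ|) * (1 + ENNReal.ofReal (8 * K * A + 1)) := by
        gcongr
    _ = ENNReal.ofReal (2 / |Real.log δ| * (1 + (8 * K * A + 1))) := by
        rw [← ENNReal.ofReal_one, ← ENNReal.ofReal_add zero_le_one (by positivity),
          ← ENNReal.ofReal_mul (by positivity)]
    _ ≤ _ := by
        apply ENNReal.ofReal_le_ofReal
        rw [div_mul_eq_mul_div]
        refine div_le_div_of_nonneg_right ?_ hL.le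
        nlinarith [mul_nonneg hK0 hA0]
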